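/- arXiv:1902.03339 — 5 statements merged into one kernel-verified Lean document; each statement's English description precedes it below -/
import Mathlib

section
/- Suppose every infimum over actions in the recursion defining the value functions V*_t is attained. Then the optimal worst-case cost satisfies inf over all strategies η of J(η) = sup over n₁ ∈ 𝒩₁ of V*_1(Π₁(n₁), n₁ᵒ), and there exists a strategy η* achieving this value. -/
noncomputable section

/-- A finite-horizon minimax control system over times `1, …, T` (0-indexed below):
state space `𝒮 = 𝒮ʰ × 𝒮ᵒ`, observations in `O`, actions in `A`, noise in `N`
(the initial noise, which is the initial state, lies in `N1 ⊆ 𝒮`). -/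
structure MMSys (Sh So O A N : Type) where
  /-- Horizon. -/
  T : ℕ
  /-- Range of the initial noise `N₁ ⊆ 𝒮` (the initial state is `S₁ = N₁`). -/
  N1 : Set (Sh × So)
  /-- Range of the noise driving the transition into (0-indexed) time `t ≥ 1`. -/
  Nt : ℕ → Set N
  /-- Dynamics: `f t` produces the state at (0-indexed) time `t ≥ 1`. -/
  f : ℕ → (Sh × So) → A → N → (Sh × So)
  /-- Initial observation function `O₁ = h₁(S₁)`. -/
  h0 : (Sh × So) → O
  /-- Observation functions: `h t` produces the observation at time `t ≥ 1`. -/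
  h : ℕ → (Sh × So) → A → N → O
  /-- Admissible actions, depending on the observable part of the state. -/
  Aset : So → Set A
  /-- Instantaneous cost `ρ_t`. -/
  cost : ℕ → (Sh × So) → A → ℝ

namespace MMSys

variable {Sh So O A N : Type} (M : MMSys Sh So O A N)

/-- Admissible noise realizations: the initial noise together with the later ones. -/
def Omega : Set ((Sh × So) × (ℕ → N)) :=
  {ω | ω.1 ∈ M.N1 ∧ ∀ t, ω.2 t ∈ M.Nt t}

/-- State trajectory induced by an action assignment. -/
def St (act : ℕ → ((Sh × So) × (ℕ → N)) → A) : ℕ → ((Sh × So) × (ℕ → N)) → Sh × So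
  | 0 => fun ω => ω.1
  | t + 1 => fun ω => M.f (t + 1) (St act t ω) (act t ω) (ω.2 (t + 1))

/-- Observation trajectory induced by an action assignment. -/
def Obs (act : ℕ → ((Sh × So) × (ℕ → N)) → A) : ℕ → ((Sh × So) × (ℕ → N)) → O
  | 0 => fun ω => M.h0 ω.1
  | t + 1 => fun ω => M.h (t + 1) (M.St act t ω) (act t ω) (ω.2 (t + 1))

/-- Two noise realizations produce the same information history
`Q_t = (O_{1:t}, S^o_{1:t}, A_{1:t−1})`. -/
def histEq (act : ℕ → ((Sh × So) × (ℕ → N)) → A) (t : ℕ)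
    (ω ω' : (Sh × So) × (ℕ → N)) : Prop :=
  (∀ i ≤ t, M.Obs act i ω = M.Obs act i ω') ∧
  (∀ i ≤ t, (M.St act i ω).2 = (M.St act i ω').2) ∧
  (∀ i < t, act i ω = act i ω')

/-- A strategy `η`: an admissible action assignment `A_t = η_t(Q_t)` which is a
function of the information history `Q_t`. -/
structure Strategy where
  /-- The action taken at time `t` on the realization `ω`. -/
  act : ℕ → ((Sh × So) × (ℕ → N)) → A
  admissible : ∀ t ω, t < M.T → ω ∈ M.Omega → act t ω ∈ M.Aset (M.St act t ω).2
  adapted : ∀ t ω ω', t < M.T → ω ∈ M.Omega → ω' ∈ M.Omega →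
    M.histEq act t ω ω' → act t ω = act t ω'

/-- Worst-case maximum instantaneous cost
`J(η) = sup_{noise} max_{1 ≤ t ≤ T} ρ_t(S_t, A_t)`. -/
def J (η : M.Strategy) : ℝ :=
  sSup {c : ℝ | ∃ ω ∈ M.Omega,
    c = ⨆ t : Fin M.T, M.cost t (M.St η.act t ω) (η.act t ω)}

/-- Updated information state `Π′` after taking action `a` at information state
`(π, so)` and observing the data generated by the hidden state `sh` and noise `nn`
(here `t` is the arrival time index). -/
def nextSet (t : ℕ) (π : Set Sh) (so : So) (a : A) (sh : Sh) (nn : N) : Set Sh :=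
  {zh | ∃ z0h ∈ π, ∃ m ∈ M.Nt t,
    M.f t (z0h, so) a m = (zh, (M.f t (sh, so) a nn).2) ∧
    M.h t (z0h, so) a m = M.h t (sh, so) a nn}

/-- Terminal inner cost `sup_{sʰ ∈ π} ρ_T((sʰ, sᵒ), a)`. -/
def termCost (π : Set Sh) (so : So) (a : A) : ℝ :=
  sSup {c : ℝ | ∃ sh ∈ π, c = M.cost (M.T - 1) (sh, so) a}

/-- Intermediate inner cost at (0-indexed) time `i`, given the value function at
the next time: `sup_{sʰ ∈ π, n ∈ 𝒩_{t+1}} max( ρ_t, V_{t+1}(Π′, (s′)ᵒ) )`. -/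
def stepCost (i : ℕ) (Vnext : Set Sh → So → ℝ) (π : Set Sh) (so : So) (a : A) : ℝ :=
  sSup {c : ℝ | ∃ sh ∈ π, ∃ nn ∈ M.Nt (i + 1),
    c = max (M.cost i (sh, so) a)
      (Vnext (M.nextSet (i + 1) π so a sh nn) ((M.f (i + 1) (sh, so) a nn).2))}

/-- Value functions, indexed by the number `k` of remaining steps
(`Vaux k` is `V*_t` for the 0-indexed time `t = T − 1 − k`). -/
def Vaux : ℕ → Set Sh → So → ℝ
  | 0 => fun π so => sInf (M.termCost π so '' M.Aset so)
  | k + 1 => fun π so => sInf (M.stepCost (M.T - 2 - k) (Vaux k) π so '' M.Aset so)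

/-- `Vstar i`: value function `V*` at (0-indexed) time `i`. -/
def Vstar (i : ℕ) : Set Sh → So → ℝ := M.Vaux (M.T - 1 - i)

/-- The inner cost minimized over actions at each stage of the recursion
defining `Vaux`. -/
def innerCost : ℕ → Set Sh → So → A → ℝ
  | 0 => M.termCost
  | k + 1 => M.stepCost (M.T - 2 - k) (M.Vaux k)

/-- Initial information state `Π₁(n₁)`. -/
def Pi1 (n1 : Sh × So) : Set Sh :=
  {zh | (zh, n1.2) ∈ M.N1 ∧ M.h0 (zh, n1.2) = M.h0 n1}

section InformationState

/-- Information state after `t` transitions under an action assignment. -/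
def infoState (act : ℕ → ((Sh × So) × (ℕ → N)) → A) : ℕ → ((Sh × So) × (ℕ → N)) → Set Sh
  | 0 => fun ω => M.Pi1 ω.1
  | t + 1 => fun ω => M.nextSet (t + 1) (infoState act t ω) (M.St act t ω).2 (act t ω)
      (M.St act t ω).1 (ω.2 (t + 1))

variable {M}

theorem histEq.mono {act : ℕ → ((Sh × So) × (ℕ → N)) → A} {s t : ℕ}
    {ω ω' : (Sh × So) × (ℕ → N)} (h : M.histEq act t ω ω') (hst : s ≤ t) :
    M.histEq act s ω ω' :=
  ⟨fun i hi => h.1 i (hi.trans hst), fun i hi => h.2.1 i (hi.trans hst),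
    fun i hi => h.2.2 i (hi.trans_le hst)⟩

theorem histEq.trans {act : ℕ → ((Sh × So) × (ℕ → N)) → A} {t : ℕ}
    {ω ω' ω'' : (Sh × So) × (ℕ → N)} (h : M.histEq act t ω ω') (h' : M.histEq act t ω' ω'') :
    M.histEq act t ω ω'' :=
  ⟨fun i hi => (h.1 i hi).trans (h'.1 i hi), fun i hi => (h.2.1 i hi).trans (h'.2.1 i hi),
    fun i hi => (h.2.2 i hi).trans (h'.2.2 i hi)⟩

theorem histEq.succ {act : ℕ → ((Sh × So) × (ℕ → N)) → A} {t : ℕ}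
    {ω ω' : (Sh × So) × (ℕ → N)} (h : M.histEq act t ω ω')
    (hobs : M.Obs act (t + 1) ω = M.Obs act (t + 1) ω')
    (hst : (M.St act (t + 1) ω).2 = (M.St act (t + 1) ω').2)
    (hact : act t ω = act t ω') : M.histEq act (t + 1) ω ω' := by
  refine ⟨fun i hi => ?_, fun i hi => ?_, fun i hi => ?_⟩
  · rcases Nat.le_succ_iff.1 hi with hi | rfl
    exacts [h.1 i hi, hobs]
  · rcases Nat.le_succ_iff.1 hi with hi | rfl
    exacts [h.2.1 i hi, hst]
  · rcases Nat.lt_succ_iff_lt_or_eq.1 hi with hi | rfl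
    exacts [h.2.2 i hi, hact]

theorem infoState_eq_of_histEq {act : ℕ → ((Sh × So) × (ℕ → N)) → A} {t : ℕ}
    {ω ω' : (Sh × So) × (ℕ → N)} (h : M.histEq act t ω ω') :
    M.infoState act t ω = M.infoState act t ω' := by
  induction t with
  | zero =>
    have h1 : M.h0 ω.1 = M.h0 ω'.1 := h.1 0 le_rfl
    have h2 : ω.1.2 = ω'.1.2 := h.2.1 0 le_rfl
    simp only [infoState, Pi1, h1, h2]
  | succ t ih =>
    have h1 := h.1 (t + 1) le_rfl
    have h2 := h.2.1 (t + 1) le_rfl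
    simp only [Obs, St] at h1 h2
    simp only [infoState, nextSet, Prod.mk.eta, h1, h2]
    rw [ih (h.mono t.le_succ), h.2.1 t t.le_succ, h.2.2 t t.lt_succ_self]

theorem St_fst_mem_infoState (act : ℕ → ((Sh × So) × (ℕ → N)) → A) (t : ℕ)
    {ω : (Sh × So) × (ℕ → N)} (hω : ω ∈ M.Omega) :
    (M.St act t ω).1 ∈ M.infoState act t ω := by
  induction t with
  | zero => exact ⟨hω.1, rfl⟩
  | succ t ih => exact ⟨_, ih, _, hω.2 (t + 1), rfl, rfl⟩

end InformationState

section Strategies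

variable {M}

/-- Strategies are nonanticipative. -/
theorem Strategy.eq_of_noise_eq (η : M.Strategy) {t : ℕ} {ω ω' : (Sh × So) × (ℕ → N)}
    (hω : ω ∈ M.Omega) (hω' : ω' ∈ M.Omega) (h0 : ω.1 = ω'.1)
    (hn : ∀ i ≤ t, ω.2 i = ω'.2 i) (ht : t < M.T) :
    M.histEq η.act t ω ω' ∧ M.St η.act t ω = M.St η.act t ω' := by
  induction t with
  | zero =>
    refine ⟨⟨fun i hi => ?_, fun i hi => ?_, fun i hi => absurd hi (Nat.not_lt_zero i)⟩, h0⟩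
    · obtain rfl := Nat.le_zero.1 hi
      exact congrArg M.h0 h0
    · obtain rfl := Nat.le_zero.1 hi
      exact congrArg Prod.snd h0
  | succ t ih =>
    obtain ⟨hh, hs⟩ := ih (fun i hi => hn i (hi.trans t.le_succ)) (t.lt_succ_self.trans ht)
    have ha := η.adapted t ω ω' (t.lt_succ_self.trans ht) hω hω' hh
    have hs' : M.St η.act (t + 1) ω = M.St η.act (t + 1) ω' := by
      simp only [St, hs, ha, hn (t + 1) le_rfl]
    refine ⟨hh.succ ?_ (congrArg Prod.snd hs') ha, hs'⟩
    simp only [Obs, hs, ha, hn (t + 1) le_rfl]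

theorem Strategy.exists_noise_succ_eq (η : M.Strategy) {t : ℕ} {ω : (Sh × So) × (ℕ → N)}
    (hω : ω ∈ M.Omega) (ht : t < M.T) {m : N} (hm : m ∈ M.Nt (t + 1)) :
    ∃ ω' ∈ M.Omega, ω'.2 (t + 1) = m ∧ M.histEq η.act t ω ω' ∧
      M.St η.act t ω = M.St η.act t ω' := by
  have hω' : (ω.1, Function.update ω.2 (t + 1) m) ∈ M.Omega := by
    refine ⟨hω.1, fun i => ?_⟩
    rcases eq_or_ne i (t + 1) with rfl | hi
    · simpa using hm
    · simpa [hi] using hω.2 i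
  refine ⟨_, hω', by simp, η.eq_of_noise_eq hω hω' rfl (fun i hi => ?_) ht⟩
  exact (Function.update_of_ne (by omega) _ _).symm

/-- Every point of the information state is the hidden state of a realization with the
same history. -/
theorem Strategy.exists_St_eq_of_mem_infoState (η : M.Strategy) {t : ℕ} (ht : t < M.T)
    {ω : (Sh × So) × (ℕ → N)} (hω : ω ∈ M.Omega) {z : Sh}
    (hz : z ∈ M.infoState η.act t ω) :
    ∃ ω' ∈ M.Omega, M.histEq η.act t ω ω' ∧
      M.St η.act t ω' = (z, (M.St η.act t ω).2) := by
  induction t generalizing z with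
  | zero =>
    refine ⟨((z, ω.1.2), ω.2), ⟨hz.1, hω.2⟩,
      ⟨fun i hi => ?_, fun i hi => ?_, fun i hi => absurd hi (Nat.not_lt_zero i)⟩, rfl⟩
    · obtain rfl := Nat.le_zero.1 hi
      exact hz.2.symm
    · obtain rfl := Nat.le_zero.1 hi
      rfl
  | succ t ih =>
    have ht' : t < M.T := t.lt_succ_self.trans ht
    obtain ⟨z₀, hz₀, m, hm, hf, hh⟩ := hz
    obtain ⟨ω₁, hω₁, hist₁, hs₁⟩ := ih ht' hz₀
    obtain ⟨ω₂, hω₂, rfl, hist₂, hs₂⟩ := η.exists_noise_succ_eq hω₁ ht' hm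
    have hist := hist₁.trans hist₂
    have ha := η.adapted t ω ω₂ ht' hω hω₂ hist
    have hs : M.St η.act (t + 1) ω₂ = (z, (M.St η.act (t + 1) ω).2) := by
      simp only [St, ← hs₂, hs₁, ← ha, hf]
    refine ⟨ω₂, hω₂, hist.succ ?_ (by rw [hs]) ha, hs⟩
    simp only [Obs, ← hs₂, hs₁, ← ha, hh]

end Strategies

section FeedbackLaw

/-- Joint trajectory of the information state and the state under the feedback law `μ`. -/
def feedbackTraj (μ : ℕ → Set Sh → So → A) :
    ℕ → ((Sh × So) × (ℕ → N)) → Set Sh × (Sh × So)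
  | 0 => fun ω => (M.Pi1 ω.1, ω.1)
  | t + 1 => fun ω =>
    let p := feedbackTraj μ t ω
    (M.nextSet (t + 1) p.1 p.2.2 (μ t p.1 p.2.2) p.2.1 (ω.2 (t + 1)),
      M.f (t + 1) p.2 (μ t p.1 p.2.2) (ω.2 (t + 1)))

/-- Action assignment generated by the feedback law `μ`. -/
def feedbackAct (μ : ℕ → Set Sh → So → A) (t : ℕ) (ω : (Sh × So) × (ℕ → N)) : A :=
  μ t (M.feedbackTraj μ t ω).1 (M.feedbackTraj μ t ω).2.2

theorem feedbackTraj_eq (μ : ℕ → Set Sh → So → A) (t : ℕ) (ω : (Sh × So) × (ℕ → N)) :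
    M.feedbackTraj μ t ω =
      (M.infoState (M.feedbackAct μ) t ω, M.St (M.feedbackAct μ) t ω) := by
  induction t with
  | zero => rfl
  | succ t ih => simp only [feedbackTraj, infoState, St, feedbackAct, ih]

theorem feedbackAct_eq (μ : ℕ → Set Sh → So → A) (t : ℕ) (ω : (Sh × So) × (ℕ → N)) :
    M.feedbackAct μ t ω =
      μ t (M.infoState (M.feedbackAct μ) t ω) (M.St (M.feedbackAct μ) t ω).2 := by
  rw [feedbackAct, feedbackTraj_eq]

/-- Strategy generated by an admissible feedback law on information states. -/
def feedbackStrategy (μ : ℕ → Set Sh → So → A)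
    (hμ : ∀ t π so, π.Nonempty → μ t π so ∈ M.Aset so) : M.Strategy where
  act := M.feedbackAct μ
  admissible t ω _ hω := by
    rw [feedbackAct_eq]
    exact hμ _ _ _ ⟨_, St_fst_mem_infoState _ t hω⟩
  adapted t ω ω' _ _ _ h := by
    rw [feedbackAct_eq, feedbackAct_eq, infoState_eq_of_histEq h, h.2.1 t le_rfl]

end FeedbackLaw

section DynamicProgramming

variable {M}

theorem Vaux_eq_sInf_innerCost (k : ℕ) (π : Set Sh) (so : So) :
    M.Vaux k π so = sInf (M.innerCost k π so '' M.Aset so) := by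
  cases k <;> rfl

theorem innerCost_last {t : ℕ} (ht : t + 1 = M.T) :
    M.innerCost (M.T - 1 - t) = M.termCost := by
  rw [show M.T - 1 - t = 0 by omega, innerCost]

theorem innerCost_step {t : ℕ} (ht : t + 1 < M.T) :
    M.innerCost (M.T - 1 - t) = M.stepCost t (M.Vstar (t + 1)) := by
  rw [show M.T - 1 - t = (M.T - 1 - (t + 1)) + 1 by omega, innerCost, Vstar,
    show M.T - 2 - (M.T - 1 - (t + 1)) = t by omega]

section Bounds

variable {B : ℝ}

theorem termCost_mem_Icc (hB : 0 ≤ B) (hc : ∀ t s a, M.cost t s a ∈ Set.Icc 0 B)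
    (π : Set Sh) (so : So) (a : A) : M.termCost π so a ∈ Set.Icc 0 B := by
  constructor
  · apply Real.sSup_nonneg
    rintro c ⟨sh, -, rfl⟩
    exact (hc _ _ _).1
  · apply Real.sSup_le _ hB
    rintro c ⟨sh, -, rfl⟩
    exact (hc _ _ _).2

theorem stepCost_mem_Icc (hB : 0 ≤ B) (hc : ∀ t s a, M.cost t s a ∈ Set.Icc 0 B)
    {V : Set Sh → So → ℝ} (hV : ∀ π so, V π so ∈ Set.Icc 0 B)
    (i : ℕ) (π : Set Sh) (so : So) (a : A) : M.stepCost i V π so a ∈ Set.Icc 0 B := by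
  constructor
  · apply Real.sSup_nonneg
    rintro c ⟨sh, -, nn, -, rfl⟩
    exact le_max_of_le_left (hc _ _ _).1
  · apply Real.sSup_le _ hB
    rintro c ⟨sh, -, nn, -, rfl⟩
    exact max_le (hc _ _ _).2 (hV _ _).2

theorem innerCost_mem_Icc (hB : 0 ≤ B) (hc : ∀ t s a, M.cost t s a ∈ Set.Icc 0 B)
    (hA : ∀ so, (M.Aset so).Nonempty) (k : ℕ) (π : Set Sh) (so : So) (a : A) :
    M.innerCost k π so a ∈ Set.Icc 0 B := by
  induction k generalizing π so a with
  | zero => exact termCost_mem_Icc hB hc π so a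
  | succ k ih =>
    refine stepCost_mem_Icc hB hc (fun π so => ?_) _ π so a
    rw [Vaux_eq_sInf_innerCost]
    obtain ⟨a₀, ha₀⟩ := hA so
    refine ⟨Real.sInf_nonneg ?_, csInf_le_of_le ⟨0, ?_⟩ ⟨a₀, ha₀, rfl⟩ (ih _ _ _).2⟩ <;>
    · rintro _ ⟨a, -, rfl⟩
      exact (ih _ _ _).1

theorem Vaux_le_innerCost (hB : 0 ≤ B) (hc : ∀ t s a, M.cost t s a ∈ Set.Icc 0 B)
    (hA : ∀ so, (M.Aset so).Nonempty) (k : ℕ) (π : Set Sh) {so : So} {a : A}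
    (ha : a ∈ M.Aset so) : M.Vaux k π so ≤ M.innerCost k π so a := by
  rw [Vaux_eq_sInf_innerCost]
  refine csInf_le ⟨0, ?_⟩ ⟨a, ha, rfl⟩
  rintro _ ⟨b, -, rfl⟩
  exact (innerCost_mem_Icc hB hc hA _ _ _ _).1

theorem Vstar_mem_Icc (hB : 0 ≤ B) (hc : ∀ t s a, M.cost t s a ∈ Set.Icc 0 B)
    (hA : ∀ so, (M.Aset so).Nonempty) (t : ℕ) (π : Set Sh) (so : So) :
    M.Vstar t π so ∈ Set.Icc 0 B := by
  obtain ⟨a, ha⟩ := hA so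
  refine ⟨?_, (Vaux_le_innerCost hB hc hA _ π ha).trans (innerCost_mem_Icc hB hc hA _ _ _ _).2⟩
  rw [Vstar, Vaux_eq_sInf_innerCost]
  refine Real.sInf_nonneg ?_
  rintro _ ⟨b, -, rfl⟩
  exact (innerCost_mem_Icc hB hc hA _ _ _ _).1

theorem cost_le_innerCost (hB : 0 ≤ B) (hc : ∀ t s a, M.cost t s a ∈ Set.Icc 0 B)
    (hA : ∀ so, (M.Aset so).Nonempty) (hNt : ∀ t, (M.Nt t).Nonempty) {t : ℕ} (ht : t < M.T)
    {π : Set Sh} {sh : Sh} (hsh : sh ∈ π) (so : So) (a : A) :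
    M.cost t (sh, so) a ≤ M.innerCost (M.T - 1 - t) π so a := by
  rcases Nat.eq_or_lt_of_le (Nat.succ_le_of_lt ht) with h | h
  · rw [innerCost_last h]
    refine le_csSup ⟨B, ?_⟩ ⟨sh, hsh, ?_⟩
    · rintro c ⟨_, -, rfl⟩
      exact (hc _ _ _).2
    · rw [show M.T - 1 = t by omega]
  · rw [innerCost_step h]
    obtain ⟨n, hn⟩ := hNt (t + 1)
    refine le_csSup_of_le ⟨B, ?_⟩ ⟨sh, hsh, n, hn, rfl⟩ (le_max_left _ _)
    rintro c ⟨_, -, _, -, rfl⟩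
    exact max_le (hc _ _ _).2 (Vstar_mem_Icc hB hc hA _ _ _).2

theorem Vstar_succ_le_innerCost (hB : 0 ≤ B) (hc : ∀ t s a, M.cost t s a ∈ Set.Icc 0 B)
    (hA : ∀ so, (M.Aset so).Nonempty) {t : ℕ} (ht : t + 1 < M.T)
    {π : Set Sh} {sh : Sh} (hsh : sh ∈ π) (so : So) (a : A) {n : N} (hn : n ∈ M.Nt (t + 1)) :
    M.Vstar (t + 1) (M.nextSet (t + 1) π so a sh n) (M.f (t + 1) (sh, so) a n).2 ≤
      M.innerCost (M.T - 1 - t) π so a := by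
  rw [innerCost_step ht]
  refine le_csSup_of_le ⟨B, ?_⟩ ⟨sh, hsh, n, hn, rfl⟩ (le_max_right _ _)
  rintro c ⟨_, -, _, -, rfl⟩
  exact max_le (hc _ _ _).2 (Vstar_mem_Icc hB hc hA _ _ _).2

theorem cost_le_J (hB : 0 ≤ B) (hc : ∀ t s a, M.cost t s a ∈ Set.Icc 0 B) (η : M.Strategy)
    {t : ℕ} (ht : t < M.T) {ω : (Sh × So) × (ℕ → N)} (hω : ω ∈ M.Omega) :
    M.cost t (M.St η.act t ω) (η.act t ω) ≤ M.J η := by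
  refine le_csSup_of_le ⟨B, ?_⟩ ⟨ω, hω, rfl⟩
    (le_ciSup (f := fun t : Fin M.T => M.cost t (M.St η.act t ω) (η.act t ω))
      (Set.finite_range _).bddAbove ⟨t, ht⟩)
  rintro c ⟨ω', -, rfl⟩
  exact Real.iSup_le (fun t => (hc _ _ _).2) hB

/-- Along any strategy, the value of the information state is at most the worst-case cost. -/
theorem Vstar_infoState_le_J (hB : 0 ≤ B) (hc : ∀ t s a, M.cost t s a ∈ Set.Icc 0 B)
    (hA : ∀ so, (M.Aset so).Nonempty) (η : M.Strategy) {t : ℕ} (ht : t < M.T)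
    {ω : (Sh × So) × (ℕ → N)} (hω : ω ∈ M.Omega) :
    M.Vstar t (M.infoState η.act t ω) (M.St η.act t ω).2 ≤ M.J η := by
  have hJ : 0 ≤ M.J η := (hc _ _ _).1.trans (cost_le_J hB hc η ht hω)
  obtain ⟨k, hk⟩ : ∃ k, t + 1 + k = M.T := Nat.exists_eq_add_of_le ht |>.imp fun _ h => h.symm
  induction k generalizing t ω with
  | zero =>
    refine (Vaux_le_innerCost hB hc hA _ _ (η.admissible t ω ht hω)).trans ?_
    rw [innerCost_last hk]
    refine Real.sSup_le ?_ hJ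
    rintro c ⟨sh, hsh, rfl⟩
    obtain ⟨ω', hω', hist, hs⟩ := η.exists_St_eq_of_mem_infoState ht hω hsh
    have hle := cost_le_J hB hc η ht hω'
    rw [hs, ← η.adapted t ω ω' ht hω hω' hist] at hle
    rwa [show M.T - 1 = t by omega]
  | succ k ih =>
    have ht' : t + 1 < M.T := by omega
    refine (Vaux_le_innerCost hB hc hA _ _ (η.admissible t ω ht hω)).trans ?_
    rw [innerCost_step ht']
    refine Real.sSup_le ?_ hJ
    rintro c ⟨sh, hsh, n, hn, rfl⟩
    obtain ⟨ω₁, hω₁, hist₁, hs₁⟩ := η.exists_St_eq_of_mem_infoState ht hω hsh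
    obtain ⟨ω₂, hω₂, rfl, hist₂, hs₂⟩ := η.exists_noise_succ_eq hω₁ ht hn
    have hist := hist₁.trans hist₂
    have ha := η.adapted t ω ω₂ ht hω hω₂ hist
    have hs := hs₂.symm.trans hs₁
    refine max_le ?_ ?_
    · have hle := cost_le_J hB hc η ht hω₂
      rwa [hs, ← ha] at hle
    · have hle := ih ht' hω₂ (by omega)
      simpa only [infoState, St, hs, ← ha, ← infoState_eq_of_histEq hist] using hle

/-- Along a strategy attaining the minimum at every stage, the value of the information
state does not increase. -/
theorem Vstar_infoState_le_Vstar_zero (hB : 0 ≤ B)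
    (hc : ∀ t s a, M.cost t s a ∈ Set.Icc 0 B) (hA : ∀ so, (M.Aset so).Nonempty)
    {act : ℕ → ((Sh × So) × (ℕ → N)) → A} {ω : (Sh × So) × (ℕ → N)} (hω : ω ∈ M.Omega)
    (hopt : ∀ t, M.innerCost (M.T - 1 - t) (M.infoState act t ω) (M.St act t ω).2 (act t ω) =
      M.Vstar t (M.infoState act t ω) (M.St act t ω).2) {t : ℕ} (ht : t < M.T) :
    M.Vstar t (M.infoState act t ω) (M.St act t ω).2 ≤ M.Vstar 0 (M.Pi1 ω.1) ω.1.2 := by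
  induction t with
  | zero => exact le_rfl
  | succ t ih =>
    refine le_trans ?_ (ih (t.lt_succ_self.trans ht))
    rw [← hopt t]
    exact Vstar_succ_le_innerCost hB hc hA ht (St_fst_mem_infoState act t hω) _ _
      (hω.2 (t + 1))

end Bounds

end DynamicProgramming

end MMSys


/-- if every infimum over actions in the recursion defining `V*` is
attained, then `inf_η J(η) = sup_{n₁ ∈ 𝒩₁} V*_1(Π₁(n₁), n₁ᵒ)` and some strategy
`η*` achieves this value. -/
theorem stmt0 {Sh So O A N : Type} (M : MMSys Sh So O A N) (hT : 0 < M.T)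
    (hN1 : M.N1.Nonempty) (hNt : ∀ t, (M.Nt t).Nonempty)
    (hA : ∀ so, (M.Aset so).Nonempty)
    (hcost_nonneg : ∀ t s a, 0 ≤ M.cost t s a)
    (hcost_bdd : ∃ B, ∀ t s a, M.cost t s a ≤ B)
    (hattain : ∀ (k : ℕ) (π : Set Sh) (so : So), π.Nonempty →
      ∃ a ∈ M.Aset so, M.innerCost k π so a = M.Vaux k π so) :
    (⨅ η : M.Strategy, M.J η) =
      sSup {r : ℝ | ∃ n1 ∈ M.N1, r = M.Vstar 0 (M.Pi1 n1) n1.2} ∧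
    ∃ η : M.Strategy, M.J η =
      sSup {r : ℝ | ∃ n1 ∈ M.N1, r = M.Vstar 0 (M.Pi1 n1) n1.2} := by
  obtain ⟨B', hB'⟩ := hcost_bdd
  obtain ⟨B, hB, hc⟩ : ∃ B : ℝ, 0 ≤ B ∧ ∀ t s a, M.cost t s a ∈ Set.Icc 0 B :=
    ⟨max B' 0, le_max_right _ _,
      fun t s a => ⟨hcost_nonneg t s a, le_max_of_le_left (hB' t s a)⟩⟩
  choose ν hν using hNt
  set v := sSup {r : ℝ | ∃ n1 ∈ M.N1, r = M.Vstar 0 (M.Pi1 n1) n1.2}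
  have hlower (η : M.Strategy) : v ≤ M.J η := by
    obtain ⟨n₀, hn₀⟩ := hN1
    refine csSup_le ⟨_, n₀, hn₀, rfl⟩ ?_
    rintro r ⟨n1, hn1, rfl⟩
    exact M.Vstar_infoState_le_J hB hc hA η hT (ω := (n1, ν)) ⟨hn1, hν⟩
  obtain ⟨η, hη⟩ : ∃ η : M.Strategy, M.J η ≤ v := by
    obtain ⟨n₀, hn₀⟩ := hN1
    have : Nonempty A := (hA n₀.2).to_type
    choose! μ hμ hopt using hattain
    refine ⟨M.feedbackStrategy (fun t => μ (M.T - 1 - t)) fun t π so h => hμ _ _ _ h, ?_⟩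
    refine csSup_le ⟨_, (n₀, ν), ⟨hn₀, hν⟩, rfl⟩ ?_
    rintro c ⟨ω, hω, rfl⟩
    have : Nonempty (Fin M.T) := ⟨⟨0, hT⟩⟩
    refine ciSup_le fun t => ?_
    set act := M.feedbackAct (fun t => μ (M.T - 1 - t))
    have hopt' (t : ℕ) : M.innerCost (M.T - 1 - t) (M.infoState act t ω) (M.St act t ω).2
        (act t ω) = M.Vstar t (M.infoState act t ω) (M.St act t ω).2 := by
      rw [show act t ω = _ from M.feedbackAct_eq _ t ω]
      exact hopt _ _ _ ⟨_, MMSys.St_fst_mem_infoState act t hω⟩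
    calc M.cost t (M.St act t ω) (act t ω)
        ≤ M.Vstar t (M.infoState act t ω) (M.St act t ω).2 := by
          rw [← hopt']
          exact MMSys.cost_le_innerCost hB hc hA (fun t => ⟨ν t, hν t⟩) t.2
            (MMSys.St_fst_mem_infoState act t hω) _ _
      _ ≤ M.Vstar 0 (M.Pi1 ω.1) ω.1.2 :=
          MMSys.Vstar_infoState_le_Vstar_zero hB hc hA hω hopt' t.2
      _ ≤ v := by
          refine le_csSup ⟨B, ?_⟩ ⟨ω.1, hω.1, rfl⟩
          rintro r ⟨n1, -, rfl⟩
          exact (MMSys.Vstar_mem_Icc hB hc hA _ _ _).2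
  have hηv : M.J η = v := le_antisymm hη (hlower η)
  have : Nonempty M.Strategy := ⟨η⟩
  refine ⟨le_antisymm ?_ (le_ciInf hlower), η, hηv⟩
  exact (ciInf_le ⟨v, Set.forall_mem_range.2 hlower⟩ η).trans hη
end
end

section
/- For every estimation strategy g, the infimum of J(f, g) over all transmission strategies f equals the infimum of J(f, g) over transmission strategies of the restricted form U_t = f_t(X_t, Y_{1:t−1}), i.e. transmission strategies depending only on the current source state and the past channel outputs lose no performance. -/
open scoped ENNReal

noncomputable section

abbrev Euc (n : ℕ) := EuclideanSpace ℝ (Fin n)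

variable {n : ℕ}

/-- Source trajectory: `X_1 = n_1`, `X_{t+1} = λ A X_t + n_{t+1}` (0-indexed). -/
def srcX (lam : ℝ) (A : Euc n ≃ₗᵢ[ℝ] Euc n) (ν : ℕ → Euc n) : ℕ → Euc n
  | 0 => ν 0
  | t + 1 => lam • A (srcX lam A ν t) + ν (t + 1)

/-- Admissible noise sequences: `‖n_t‖ ≤ a_t` throughout the horizon. -/
def Noise (n : ℕ) (T : ℕ) (a : ℕ → ℝ) : Set (ℕ → Euc n) := {ν | ∀ t < T, ‖ν t‖ ≤ a t}

/-- A transmission strategy, encoded by the transmission decisions it induces on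
noise realizations.  `adapted` says the decision at time `t` is a function of the
information `(X_{1:t}, E_{1:t}, Y_{1:t-1})` available to the sensor (equivalently,
since the energy levels and channel outputs are themselves determined by `X_{1:t}`
and the strategy, a function of `X_{1:t}`); `energy_ok` says a transmission can
occur only when the remaining energy `E_t = K − Σ_{i<t} U_i` is positive. -/
structure TxStrategy (lam : ℝ) (A : Euc n ≃ₗᵢ[ℝ] Euc n) (T K : ℕ) where
  U : (ℕ → Euc n) → ℕ → Bool
  energy_ok : ∀ ν t, t < T → U ν t = true →
    (∑ i ∈ Finset.range t, (if U ν i then 1 else 0)) < K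
  adapted : ∀ ν ν' t, t < T →
    (∀ i ≤ t, srcX lam A ν i = srcX lam A ν' i) → U ν t = U ν' t

/-- Channel output: `Y_t = X_t` if `U_t = 1`, and `Y_t = ε` (i.e. `none`) otherwise. -/
def chOut (lam : ℝ) (A : Euc n ≃ₗᵢ[ℝ] Euc n) (U : (ℕ → Euc n) → ℕ → Bool)
    (ν : ℕ → Euc n) (t : ℕ) : Option (Euc n) :=
  if U ν t then some (srcX lam A ν t) else none

/-- An estimation strategy: `X̂_t = g_t(Y_{1:t})`. -/
def EstStrategy (n : ℕ) : Type := (t : ℕ) → (Fin (t + 1) → Option (Euc n)) → Euc n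

/-- Worst-case maximum instantaneous estimation error
`J(f, g) = sup_{noise} max_{1≤t≤T} ‖X_t − X̂_t‖` (valued in `ℝ≥0∞`). -/
def Jcost (lam : ℝ) (A : Euc n ≃ₗᵢ[ℝ] Euc n) (T K : ℕ) (a : ℕ → ℝ)
    (f : TxStrategy lam A T K) (g : EstStrategy n) : ℝ≥0∞ :=
  ⨆ ν ∈ Noise n T a, ⨆ t : Fin T,
    ENNReal.ofReal ‖srcX lam A ν t - g t (fun i => chOut lam A f.U ν i)‖


/-- A transmission strategy is of the restricted form `U_t = f_t(X_t, Y_{1:t−1})`: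
its decision at time `t` depends only on the current source state and the past
channel outputs. -/
def Restricted {n : ℕ} (lam : ℝ) (A : Euc n ≃ₗᵢ[ℝ] Euc n) (T K : ℕ)
    (f : TxStrategy lam A T K) : Prop :=
  ∀ ν ν' t, t < T → srcX lam A ν t = srcX lam A ν' t →
    (∀ i < t, chOut lam A f.U ν i = chOut lam A f.U ν' i) → f.U ν t = f.U ν' t

/-- The first `t` channel outputs, padded by `none`. -/
def outHist (lam : ℝ) (A : Euc n ≃ₗᵢ[ℝ] Euc n) (U : (ℕ → Euc n) → ℕ → Bool)
    (ν : ℕ → Euc n) (t : ℕ) : ℕ → Option (Euc n) :=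
  fun i => if i < t then chOut lam A U ν i else none

/-- The number of transmissions recorded among the first `t` outputs. -/
def usedEnergy (y : ℕ → Option (Euc n)) (t : ℕ) : ℕ :=
  ∑ i ∈ Finset.range t, if (y i).isSome then 1 else 0

/-- The cost of appending the output `o` at time `t` in state `x` after the outputs `y`, when
`V` is the cost-to-go from time `t + 1` on. -/
def stageCost (lam : ℝ) (A : Euc n ≃ₗᵢ[ℝ] Euc n) (a : ℕ → ℝ) (g : EstStrategy n)
    (V : Euc n → (ℕ → Option (Euc n)) → ℝ≥0∞) (t : ℕ) (x : Euc n)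
    (y : ℕ → Option (Euc n)) (o : Option (Euc n)) : ℝ≥0∞ :=
  max (ENNReal.ofReal ‖x - g t (fun i => Function.update y t o i)‖)
    (⨆ (w : Euc n) (_ : ‖w‖ ≤ a (t + 1)), V (lam • A x + w) (Function.update y t o))

open scoped Classical in
/-- The optimal cost-to-go with `m` stages left at time `t`. -/
def costToGo (lam : ℝ) (A : Euc n ≃ₗᵢ[ℝ] Euc n) (K : ℕ) (a : ℕ → ℝ) (g : EstStrategy n) :
    ℕ → ℕ → Euc n → (ℕ → Option (Euc n)) → ℝ≥0∞
  | 0, _, _, _ => 0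
  | m + 1, t, x, y =>
    let Q := stageCost lam A a g (costToGo lam A K a g m (t + 1)) t x y
    if usedEnergy y t < K then min (Q none) (Q (some x)) else Q none

open scoped Classical in
/-- The optimal transmission decision in state `x` after the outputs `y`. -/
def greedy (lam : ℝ) (A : Euc n ≃ₗᵢ[ℝ] Euc n) (T K : ℕ) (a : ℕ → ℝ) (g : EstStrategy n)
    (t : ℕ) (x : Euc n) (y : ℕ → Option (Euc n)) : Bool :=
  let Q := stageCost lam A a g (costToGo lam A K a g (T - (t + 1)) (t + 1)) t x y
  decide (usedEnergy y t < K ∧ Q (some x) ≤ Q none)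

/-- The outputs before time `t` generated by the decision rule `d`. -/
def ruleHist (lam : ℝ) (A : Euc n ≃ₗᵢ[ℝ] Euc n)
    (d : ℕ → Euc n → (ℕ → Option (Euc n)) → Bool) (ν : ℕ → Euc n) :
    ℕ → ℕ → Option (Euc n)
  | 0 => fun _ => none
  | t + 1 => Function.update (ruleHist lam A d ν t) t
      (if d t (srcX lam A ν t) (ruleHist lam A d ν t) then some (srcX lam A ν t) else none)

/-- The transmission decisions generated by the decision rule `d`. -/
def ruleTx (lam : ℝ) (A : Euc n ≃ₗᵢ[ℝ] Euc n)
    (d : ℕ → Euc n → (ℕ → Option (Euc n)) → Bool) (ν : ℕ → Euc n) (t : ℕ) : Bool :=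
  d t (srcX lam A ν t) (ruleHist lam A d ν t)

section

variable (lam : ℝ) (A : Euc n ≃ₗᵢ[ℝ] Euc n)

lemma outHist_zero (U : (ℕ → Euc n) → ℕ → Bool) (ν : ℕ → Euc n) :
    outHist lam A U ν 0 = fun _ => none := by
  funext i
  simp [outHist]

lemma outHist_succ (U : (ℕ → Euc n) → ℕ → Bool) (ν : ℕ → Euc n) (t : ℕ) :
    outHist lam A U ν (t + 1) =
      Function.update (outHist lam A U ν t) t (chOut lam A U ν t) := by
  funext i
  rcases lt_trichotomy i t with h | rfl | h
  · simp [outHist, Function.update_of_ne h.ne, h, h.trans (Nat.lt_succ_self t)]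
  · simp [outHist]
  · simp [outHist, Function.update_of_ne h.ne', not_lt.2 h.le, h]

lemma update_outHist_restrict (U : (ℕ → Euc n) → ℕ → Bool) (ν : ℕ → Euc n)
    (t : ℕ) :
    (fun i : Fin (t + 1) => Function.update (outHist lam A U ν t) t (chOut lam A U ν t) i) =
      fun i : Fin (t + 1) => chOut lam A U ν i := by
  rw [← outHist_succ]
  funext i
  simp [outHist, i.2]

lemma usedEnergy_outHist (U : (ℕ → Euc n) → ℕ → Bool) (ν : ℕ → Euc n) (t : ℕ) :
    usedEnergy (outHist lam A U ν t) t =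
      ∑ i ∈ Finset.range t, (if U ν i then 1 else 0) := by
  refine Finset.sum_congr rfl fun i hi => ?_
  rw [Finset.mem_range] at hi
  cases h : U ν i <;> simp [outHist, hi, chOut, h]

lemma ruleHist_eq_outHist (d : ℕ → Euc n → (ℕ → Option (Euc n)) → Bool) (ν : ℕ → Euc n)
    (t : ℕ) : ruleHist lam A d ν t = outHist lam A (ruleTx lam A d) ν t := by
  induction t with
  | zero => rw [outHist_zero, ruleHist]
  | succ t ih => rw [outHist_succ, ← ih]; rfl

lemma ruleHist_congr (d : ℕ → Euc n → (ℕ → Option (Euc n)) → Bool) {ν ν' : ℕ → Euc n} {t : ℕ}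
    (h : ∀ i < t, srcX lam A ν i = srcX lam A ν' i) :
    ruleHist lam A d ν t = ruleHist lam A d ν' t := by
  induction t with
  | zero => rfl
  | succ t ih =>
    rw [ruleHist, ruleHist, ih fun i hi => h i (by lia), h t (by lia)]

/-- The strategy that follows the optimal decision rule. -/
def greedyStrategy (T K : ℕ) (a : ℕ → ℝ) (g : EstStrategy n) : TxStrategy lam A T K where
  U := ruleTx lam A (greedy lam A T K a g)
  energy_ok ν t _ h := by
    rw [← usedEnergy_outHist, ← ruleHist_eq_outHist]
    exact (of_decide_eq_true h).1
  adapted ν ν' t _ h := by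
    rw [ruleTx, ruleTx, ruleHist_congr lam A _ fun i hi => h i hi.le, h t le_rfl]

lemma greedyStrategy_U (T K : ℕ) (a : ℕ → ℝ) (g : EstStrategy n) (ν : ℕ → Euc n) (t : ℕ) :
    (greedyStrategy lam A T K a g).U ν t = greedy lam A T K a g t (srcX lam A ν t)
      (outHist lam A (greedyStrategy lam A T K a g).U ν t) := by
  have h : (greedyStrategy lam A T K a g).U = ruleTx lam A (greedy lam A T K a g) := by
    simp only [greedyStrategy]
  rw [h, ← ruleHist_eq_outHist, ruleTx]

lemma restricted_greedyStrategy (T K : ℕ) (a : ℕ → ℝ) (g : EstStrategy n) :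
    Restricted lam A T K (greedyStrategy lam A T K a g) := by
  intro ν ν' t _ hx hy
  have hh : outHist lam A (greedyStrategy lam A T K a g).U ν t =
      outHist lam A (greedyStrategy lam A T K a g).U ν' t := by
    funext i
    by_cases hi : i < t
    · simp [outHist, hi, hy i hi]
    · simp [outHist, hi]
  rw [greedyStrategy_U, greedyStrategy_U, hx, hh]

lemma srcX_congr {ν ν' : ℕ → Euc n} {t : ℕ} (h : ∀ i ≤ t, ν i = ν' i) :
    srcX lam A ν t = srcX lam A ν' t := by
  induction t with
  | zero => exact h 0 le_rfl
  | succ t ih => rw [srcX, srcX, ih fun i hi => h i (by lia), h _ le_rfl]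

variable {lam A} {T K : ℕ} {a : ℕ → ℝ} {g : EstStrategy n}

lemma costToGo_le_Jcost (f : TxStrategy lam A T K) (m : ℕ) :
    ∀ (t : ℕ) (ν : ℕ → Euc n), t + m = T → ν ∈ Noise n T a →
      costToGo lam A K a g m t (srcX lam A ν t) (outHist lam A f.U ν t) ≤
        Jcost lam A T K a f g := by
  induction m with
  | zero => intro t ν _ _; simp [costToGo]
  | succ m ih =>
    intro t ν htm hν
    have ht : t < T := by lia
    have key : stageCost lam A a g (costToGo lam A K a g m (t + 1)) t (srcX lam A ν t)
        (outHist lam A f.U ν t) (chOut lam A f.U ν t) ≤ Jcost lam A T K a f g := by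
      refine max_le ?_ (iSup₂_le fun w hw => ?_)
      · rw [update_outHist_restrict]
        exact le_iSup₂_of_le ν hν (le_iSup_of_le (⟨t, ht⟩ : Fin T) le_rfl)
      · have hν' : Function.update ν (t + 1) w ∈ Noise n T a := by
          intro s hs
          by_cases h : s = t + 1
          · subst h; simpa using hw
          · simpa [Function.update_of_ne h] using hν s hs
        have hX : ∀ i ≤ t, srcX lam A (Function.update ν (t + 1) w) i = srcX lam A ν i :=
          fun i hi => srcX_congr lam A fun j hj => Function.update_of_ne (by lia) _ _
        have hY : outHist lam A f.U (Function.update ν (t + 1) w) (t + 1) =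
            outHist lam A f.U ν (t + 1) := by
          funext i
          by_cases hi : i < t + 1
          · have hU := f.adapted (Function.update ν (t + 1) w) ν i (by lia)
              fun j hj => hX j (by lia)
            simp [outHist, hi, chOut, hU, hX i (by lia)]
          · simp [outHist, hi]
        have := ih (t + 1) _ (by lia) hν'
        rwa [hY, outHist_succ, srcX, hX t le_rfl, Function.update_self] at this
    refine le_trans ?_ key
    rw [costToGo]
    cases hU : f.U ν t with
    | false =>
      rw [show chOut lam A f.U ν t = none by simp [chOut, hU]]
      split_ifs
      exacts [min_le_left _ _, le_rfl]
    | true =>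
      rw [show chOut lam A f.U ν t = some (srcX lam A ν t) by simp [chOut, hU]]
      have he := f.energy_ok ν t ht hU
      rw [← usedEnergy_outHist] at he
      rw [if_pos he]
      exact min_le_right _ _

lemma stageCost_greedyStrategy (ν : ℕ → Euc n) {t : ℕ} (ht : t < T) :
    stageCost lam A a g (costToGo lam A K a g (T - (t + 1)) (t + 1)) t (srcX lam A ν t)
        (outHist lam A (greedyStrategy lam A T K a g).U ν t)
        (chOut lam A (greedyStrategy lam A T K a g).U ν t) =
      costToGo lam A K a g (T - t) t (srcX lam A ν t)
        (outHist lam A (greedyStrategy lam A T K a g).U ν t) := by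
  rw [show T - t = T - (t + 1) + 1 by lia, costToGo, chOut, greedyStrategy_U]
  generalize outHist lam A (greedyStrategy lam A T K a g).U ν t = y
  simp only [greedy, decide_eq_true_eq]
  by_cases he : usedEnergy y t < K
  · simp only [he, true_and, if_true]
    split_ifs with h
    · exact (min_eq_right h).symm
    · exact (min_eq_left (not_le.1 h).le).symm
  · simp [he]

lemma costToGo_greedyStrategy_le {ν : ℕ → Euc n} (hν : ν ∈ Noise n T a) {t : ℕ} (ht : t < T) :
    costToGo lam A K a g (T - t) t (srcX lam A ν t)
        (outHist lam A (greedyStrategy lam A T K a g).U ν t) ≤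
      costToGo lam A K a g T 0 (srcX lam A ν 0)
        (outHist lam A (greedyStrategy lam A T K a g).U ν 0) := by
  induction t with
  | zero => exact le_rfl
  | succ t ih =>
    refine le_trans ?_ (ih (by lia))
    rw [← stageCost_greedyStrategy ν (by lia : t < T), outHist_succ]
    exact le_max_of_le_right (le_iSup₂_of_le (ν (t + 1)) (hν _ ht) le_rfl)

lemma Jcost_greedyStrategy_le (f : TxStrategy lam A T K) :
    Jcost lam A T K a (greedyStrategy lam A T K a g) g ≤ Jcost lam A T K a f g := by
  refine iSup₂_le fun ν hν => iSup_le fun t => ?_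
  refine le_trans ?_ (costToGo_le_Jcost f T 0 ν (zero_add T) hν)
  have h := costToGo_greedyStrategy_le (lam := lam) (A := A) (K := K) (g := g) hν t.2
  rw [← stageCost_greedyStrategy ν t.2] at h
  have h₁ := (le_max_left _ _).trans h
  rw [update_outHist_restrict] at h₁
  rwa [outHist_zero] at h₁ ⊢

end

/-- for every estimation strategy `g`, restricting transmission
strategies to the form `U_t = f_t(X_t, Y_{1:t−1})` loses no performance. -/
theorem stmt2 {n : ℕ} (hn : 1 ≤ n) (lam : ℝ) (A : Euc n ≃ₗᵢ[ℝ] Euc n)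
    (T K : ℕ) (hT : 1 ≤ T) (hK : 1 ≤ K) (hKT : K < T)
    (a : ℕ → ℝ) (ha : ∀ t < T, 0 ≤ a t) (g : EstStrategy n) :
    (⨅ f : TxStrategy lam A T K, Jcost lam A T K a f g) =
      ⨅ f : {f : TxStrategy lam A T K // Restricted lam A T K f},
        Jcost lam A T K a f.1 g := by
  refine le_antisymm (le_iInf fun f => iInf_le _ f.1) (le_iInf fun f => ?_)
  exact iInf_le_of_le ⟨greedyStrategy lam A T K a g, restricted_greedyStrategy lam A T K a g⟩
    (Jcost_greedyStrategy_le f)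
end
end

section
/- For every nonempty bounded set S ⊆ ℝⁿ and every a ≥ 0, the Chebyshev radius satisfies r*(φ_a(S)) = |λ| · r*(S) + a. -/
noncomputable section

/-- Chebyshev radius of a set `S ⊆ ℝⁿ`: `r*(S) = inf_x sup_{y ∈ S} ‖y − x‖`. -/
def rad {n : ℕ} (S : Set (Euc n)) : ℝ :=
  ⨅ x : Euc n, sSup {c : ℝ | ∃ y ∈ S, c = ‖y - x‖}

/-- `φ_a(S) = {λ A x + w : x ∈ S, ‖w‖ ≤ a}`. -/
def phiSet {n : ℕ} (lam : ℝ) (A : Euc n ≃ₗᵢ[ℝ] Euc n) (a : ℝ) (S : Set (Euc n)) :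
    Set (Euc n) :=
  {z | ∃ x ∈ S, ∃ w : Euc n, ‖w‖ ≤ a ∧ z = lam • A x + w}

theorem exists_norm_le_norm_add_eq {E : Type*} [NormedAddCommGroup E] [NormedSpace ℝ E]
    [Nontrivial E] (v : E) {a : ℝ} (ha : 0 ≤ a) :
    ∃ w : E, ‖w‖ ≤ a ∧ ‖v + w‖ = ‖v‖ + a := by
  rcases eq_or_ne v 0 with rfl | hv
  · obtain ⟨w, hw⟩ := exists_norm_eq E ha
    exact ⟨w, hw.le, by simp [hw]⟩
  · have hv' : ‖v‖ ≠ 0 := norm_ne_zero_iff.mpr hv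
    have hw : ‖(a / ‖v‖) • v‖ = a := by
      rw [norm_smul, Real.norm_of_nonneg (by positivity), div_mul_cancel₀ _ hv']
    refine ⟨(a / ‖v‖) • v, hw.le, ?_⟩
    rw [(SameRay.sameRay_nonneg_smul_right v (by positivity : 0 ≤ a / ‖v‖)).norm_add, hw]

theorem bddAbove_norm_sub {n : ℕ} {S : Set (Euc n)} (hS : Bornology.IsBounded S) (x : Euc n) :
    BddAbove {c : ℝ | ∃ y ∈ S, c = ‖y - x‖} := by
  obtain ⟨C, hC⟩ := hS.exists_norm_le
  refine ⟨C + ‖x‖, ?_⟩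
  rintro _ ⟨y, hy, rfl⟩
  exact (norm_sub_le y x).trans (by gcongr; exact hC y hy)

theorem rad_le_sSup {n : ℕ} (S : Set (Euc n)) (x : Euc n) :
    rad S ≤ sSup {c : ℝ | ∃ y ∈ S, c = ‖y - x‖} := by
  refine ciInf_le ⟨0, ?_⟩ x
  rintro _ ⟨z, rfl⟩
  apply Real.sSup_nonneg
  rintro _ ⟨y, -, rfl⟩
  exact norm_nonneg _

theorem isBounded_phiSet {n : ℕ} (lam : ℝ) (A : Euc n ≃ₗᵢ[ℝ] Euc n) (a : ℝ) {S : Set (Euc n)}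
    (hS : Bornology.IsBounded S) : Bornology.IsBounded (phiSet lam A a S) := by
  obtain ⟨C, hC⟩ := hS.exists_norm_le
  refine isBounded_iff_forall_norm_le.mpr ⟨|lam| * C + a, ?_⟩
  rintro _ ⟨x, hx, w, hw, rfl⟩
  refine (norm_add_le _ _).trans ?_
  rw [norm_smul, A.norm_map, Real.norm_eq_abs]
  gcongr
  exact hC x hx

theorem norm_smul_sub_add_le_sSup_phiSet {n : ℕ} (hn : 1 ≤ n) (lam : ℝ)
    (A : Euc n ≃ₗᵢ[ℝ] Euc n) {S : Set (Euc n)} (hS : Bornology.IsBounded S) {a : ℝ}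
    (ha : 0 ≤ a) {x : Euc n} (hx : x ∈ S) (c : Euc n) :
    ‖lam • A x - c‖ + a ≤ sSup {r : ℝ | ∃ y ∈ phiSet lam A a S, r = ‖y - c‖} := by
  have : Nonempty (Fin n) := ⟨⟨0, hn⟩⟩
  obtain ⟨w, hw, h⟩ := exists_norm_le_norm_add_eq (lam • A x - c) ha
  refine le_csSup (bddAbove_norm_sub (isBounded_phiSet lam A a hS) c)
    ⟨lam • A x + w, ⟨x, hx, w, hw, rfl⟩, ?_⟩
  rw [← h, add_sub_right_comm]

theorem norm_smul_sub_smul {n : ℕ} (lam : ℝ) (A : Euc n ≃ₗᵢ[ℝ] Euc n) (x y : Euc n) :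
    ‖lam • A x - lam • A y‖ = |lam| * ‖x - y‖ := by
  rw [← smul_sub, ← map_sub, norm_smul, A.norm_map, Real.norm_eq_abs]

theorem rad_phiSet_le {n : ℕ} (lam : ℝ) (A : Euc n ≃ₗᵢ[ℝ] Euc n) {S : Set (Euc n)}
    (hS : S.Nonempty) (hSb : Bornology.IsBounded S) {a : ℝ} (ha : 0 ≤ a) :
    rad (phiSet lam A a S) ≤ |lam| * rad S + a := by
  rw [← sub_le_iff_le_add, rad.eq_def S, Real.mul_iInf_of_nonneg (abs_nonneg lam)]
  refine le_ciInf fun x => ?_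
  rw [sub_le_iff_le_add]
  refine (rad_le_sSup _ (lam • A x)).trans (csSup_le ?_ ?_)
  · obtain ⟨s, hs⟩ := hS
    exact ⟨_, _, ⟨s, hs, 0, by simpa using ha, rfl⟩, rfl⟩
  · rintro _ ⟨_, ⟨y, hy, w, hw, rfl⟩, rfl⟩
    rw [add_sub_right_comm]
    refine (norm_add_le _ _).trans ?_
    rw [norm_smul_sub_smul]
    gcongr
    exact le_csSup (bddAbove_norm_sub hSb x) ⟨y, hy, rfl⟩

theorem le_rad_phiSet {n : ℕ} (hn : 1 ≤ n) (lam : ℝ) (A : Euc n ≃ₗᵢ[ℝ] Euc n)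
    {S : Set (Euc n)} (hS : S.Nonempty) (hSb : Bornology.IsBounded S) {a : ℝ} (ha : 0 ≤ a) :
    |lam| * rad S + a ≤ rad (phiSet lam A a S) := by
  obtain ⟨s, hs⟩ := hS
  refine le_ciInf fun c => ?_
  have key := fun x hx => norm_smul_sub_add_le_sSup_phiSet hn lam A hSb ha (x := x) hx c
  rcases eq_or_ne lam 0 with rfl | hlam
  · simpa using (le_add_of_nonneg_left (norm_nonneg _)).trans (key s hs)
  · have hpos : 0 < |lam| := abs_pos.mpr hlam
    have hc : lam • A (A.symm (lam⁻¹ • c)) = c := by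
      rw [A.apply_symm_apply, smul_inv_smul₀ hlam]
    rw [← le_sub_iff_add_le, ← le_div_iff₀' hpos]
    refine (rad_le_sSup S (A.symm (lam⁻¹ • c))).trans (csSup_le ⟨_, s, hs, rfl⟩ ?_)
    rintro _ ⟨y, hy, rfl⟩
    rw [le_div_iff₀' hpos, le_sub_iff_add_le, ← norm_smul_sub_smul lam A, hc]
    exact key y hy

/-- For every nonempty bounded `S ⊆ ℝⁿ` and every `a ≥ 0`,
`r*(φ_a(S)) = |λ| · r*(S) + a`. -/
theorem stmt4 {n : ℕ} (hn : 1 ≤ n) (lam : ℝ) (A : Euc n ≃ₗᵢ[ℝ] Euc n)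
    (S : Set (Euc n)) (hS : S.Nonempty) (hSb : Bornology.IsBounded S)
    (a : ℝ) (ha : 0 ≤ a) :
    rad (phiSet lam A a S) = |lam| * rad S + a := by
  exact (rad_phiSet_le lam A hS hSb ha).antisymm (le_rad_phiSet hn lam A hS hSb ha)
end
end

section
/- The dynamic-programming value equals the optimal cost of the deterministic control problem: W̃_1(a_1, K) = min over admissible control sequences u of J^d(u). -/
noncomputable section

/-- Deterministic state: `X^d_1 = a_1` (index 0) and
`X^d_{t+1} = a_{t+1}` if `u_t = 1`, `X^d_{t+1} = |λ| X^d_t + a_{t+1}` if `u_t = 0`.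
(Everything is 0-indexed: `a i` is the paper's `a_{i+1}` and `u i` the paper's `u_{i+1}`.) -/
def Xd (lam : ℝ) (a : ℕ → ℝ) (u : ℕ → Bool) : ℕ → ℝ
  | 0 => a 0
  | t + 1 => if u t then a (t + 1) else |lam| * Xd lam a u t + a (t + 1)

/-- Admissible control sequences: at most `K` transmissions within the horizon. -/
def Adm (T K : ℕ) (u : ℕ → Bool) : Prop :=
  (∑ t ∈ Finset.range T, (if u t then 1 else 0)) ≤ K

/-- Cost of the deterministic control problem:
`J^d(u) = max_{1≤t≤T} ρ_t`, `ρ_t = X^d_t` if `u_t = 0` and `ρ_t = 0` if `u_t = 1`. -/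
def Jd (lam : ℝ) (a : ℕ → ℝ) (T : ℕ) (u : ℕ → Bool) : ℝ :=
  ⨆ t : Fin T, (if u t then 0 else Xd lam a u t)


/-- `W̃_t(r, e) = min( Ṽ_t(r, e), Ṽ_t(0, e−1) )` for `e > 0`, and `W̃_t(r, 0) = Ṽ_t(r, 0)`,
expressed as an operation on the current reduced value function `Ṽ_t`. -/
def tWfrom (tVk : ℝ → ℕ → ℝ) (r : ℝ) (e : ℕ) : ℝ :=
  if e = 0 then tVk r 0 else min (tVk r e) (tVk 0 (e - 1))

/-- Reduced value functions `Ṽ`, indexed by the number `k` of remaining steps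
(so `tVv lam a T k` is `Ṽ_t` for the paper time `t = T − k`):
`Ṽ_T(r,e) = r` and `Ṽ_t(r,e) = max( r, W̃_{t+1}(|λ| r + a_{t+1}, e) )`. -/
def tVv (lam : ℝ) (a : ℕ → ℝ) (T : ℕ) : ℕ → ℝ → ℕ → ℝ
  | 0 => fun r _ => r
  | k + 1 => fun r e => max r (tWfrom (tVv lam a T k) (|lam| * r + a (T - 1 - k)) e)

/-- Cost over the last `k + 1` times of the horizon, when the control `u` is applied from the
state `r` at time `T - 1 - k`. -/
def tailCost (lam : ℝ) (a : ℕ → ℝ) (T : ℕ) (u : ℕ → Bool) : ℕ → ℝ → ℝ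
  | 0 => fun r => if u (T - 1) then 0 else r
  | k + 1 => fun r => max (if u (T - 1 - (k + 1)) then 0 else r)
      (tailCost lam a T u k (|lam| * (if u (T - 1 - (k + 1)) then 0 else r) + a (T - 1 - k)))

theorem tWfrom_le (V : ℝ → ℕ → ℝ) (r : ℝ) (e : ℕ) (b : Bool) (hb : (if b then 1 else 0) ≤ e) :
    tWfrom V r e ≤ V (if b then 0 else r) (e - if b then 1 else 0) := by
  unfold tWfrom
  cases b <;> split_ifs with he <;> simp_all

theorem exists_tWfrom_eq (V : ℝ → ℕ → ℝ) (r : ℝ) (e : ℕ) :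
    ∃ b : Bool, (if b then 1 else 0) ≤ e ∧
      tWfrom V r e = V (if b then 0 else r) (e - if b then 1 else 0) := by
  unfold tWfrom
  by_cases he : e = 0
  · exact ⟨false, by simp [he]⟩
  · rcases min_choice (V r e) (V 0 (e - 1)) with h | h
    · exact ⟨false, by simp [he, h]⟩
    · exact ⟨true, by simpa using Nat.one_le_iff_ne_zero.2 he, by simp [he, h]⟩

theorem sum_Ico_tail_succ (T k : ℕ) (hk : k + 1 < T) (f : ℕ → ℕ) :
    ∑ t ∈ Finset.Ico (T - 1 - (k + 1)) T, f t =
      f (T - 1 - (k + 1)) + ∑ t ∈ Finset.Ico (T - 1 - k) T, f t := by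
  rw [Finset.sum_eq_sum_Ico_succ_bot (by omega), show T - 1 - (k + 1) + 1 = T - 1 - k by omega]

theorem sum_Ico_tail_zero (T : ℕ) (hT : 0 < T) (f : ℕ → ℕ) :
    ∑ t ∈ Finset.Ico (T - 1) T, f t = f (T - 1) := by
  rw [Finset.sum_eq_sum_Ico_succ_bot (by omega), show T - 1 + 1 = T by omega]
  simp

theorem tWfrom_le_tailCost (lam : ℝ) (a : ℕ → ℝ) (T : ℕ) (u : ℕ → Bool) (k : ℕ) (hk : k < T)
    (r : ℝ) (e : ℕ) (hu : ∑ t ∈ Finset.Ico (T - 1 - k) T, (if u t then 1 else 0) ≤ e) :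
    tWfrom (tVv lam a T k) r e ≤ tailCost lam a T u k r := by
  induction k generalizing r e with
  | zero =>
    rw [Nat.sub_zero, sum_Ico_tail_zero T hk] at hu
    exact tWfrom_le _ r e _ hu
  | succ k ih =>
    rw [sum_Ico_tail_succ T k hk] at hu
    refine (tWfrom_le _ r e (u (T - 1 - (k + 1))) (by omega)).trans ?_
    exact max_le_max le_rfl (ih (by omega) _ _ (by omega))

theorem tailCost_congr (lam : ℝ) (a : ℕ → ℝ) (T : ℕ) (u v : ℕ → Bool) (k : ℕ)
    (h : ∀ t, T - 1 - k ≤ t → u t = v t) (r : ℝ) :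
    tailCost lam a T u k r = tailCost lam a T v k r := by
  induction k generalizing r with
  | zero => simp only [tailCost, h (T - 1) (by omega)]
  | succ k ih =>
    simp only [tailCost, h (T - 1 - (k + 1)) le_rfl]
    rw [ih fun t ht => h t (by omega)]

theorem exists_tailCost_eq_tWfrom (lam : ℝ) (a : ℕ → ℝ) (T : ℕ) (k : ℕ) (hk : k < T)
    (r : ℝ) (e : ℕ) :
    ∃ u : ℕ → Bool, ∑ t ∈ Finset.Ico (T - 1 - k) T, (if u t then 1 else 0) ≤ e ∧
      tWfrom (tVv lam a T k) r e = tailCost lam a T u k r := by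
  induction k generalizing r e with
  | zero =>
    obtain ⟨b, hb, h⟩ := exists_tWfrom_eq (tVv lam a T 0) r e
    refine ⟨fun _ => b, ?_, h⟩
    rw [Nat.sub_zero, sum_Ico_tail_zero T hk]
    exact hb
  | succ k ih =>
    obtain ⟨b, hb, h⟩ := exists_tWfrom_eq (tVv lam a T (k + 1)) r e
    obtain ⟨v, hv, hvc⟩ := ih (by omega) (|lam| * (if b then 0 else r) + a (T - 1 - k))
      (e - if b then 1 else 0)
    have hne : ∀ t, T - 1 - k ≤ t → Function.update v (T - 1 - (k + 1)) b t = v t :=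
      fun t ht => Function.update_of_ne (by omega) _ _
    refine ⟨Function.update v (T - 1 - (k + 1)) b, ?_, ?_⟩
    · rw [sum_Ico_tail_succ T k hk, Function.update_self,
        Finset.sum_congr rfl fun t ht => by rw [hne t (Finset.mem_Ico.1 ht).1]]
      omega
    · rw [h]
      simp only [tVv, tailCost, Function.update_self]
      rw [tailCost_congr lam a T _ v k hne, hvc]

theorem Xd_succ (lam : ℝ) (a : ℕ → ℝ) (u : ℕ → Bool) (t : ℕ) :
    Xd lam a u (t + 1) = |lam| * (if u t then 0 else Xd lam a u t) + a (t + 1) := by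
  cases h : u t <;> simp [Xd, h]

theorem tailCost_le_iff (lam : ℝ) (a : ℕ → ℝ) (T : ℕ) (u : ℕ → Bool) (k : ℕ) (hk : k < T)
    (c : ℝ) :
    tailCost lam a T u k (Xd lam a u (T - 1 - k)) ≤ c ↔
      ∀ t, T - 1 - k ≤ t → t < T → (if u t then 0 else Xd lam a u t) ≤ c := by
  induction k with
  | zero =>
    refine ⟨fun h t h₁ h₂ => ?_, fun h => h (T - 1) (by omega) (by omega)⟩
    obtain rfl : t = T - 1 := by omega
    exact h
  | succ k ih =>
    have hs : T - 1 - k = T - 1 - (k + 1) + 1 := by omega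
    have hX := Xd_succ lam a u (T - 1 - (k + 1))
    rw [← hs] at hX
    simp only [tailCost]
    rw [max_le_iff, ← hX, ih (by omega)]
    refine ⟨fun h t h₁ h₂ => ?_, fun h => ⟨h _ le_rfl (by omega), fun t h₁ => h t (by omega)⟩⟩
    rcases h₁.eq_or_lt with rfl | h₁
    · exact h.1
    · exact h.2 t (by omega) h₂

theorem tailCost_eq_Jd (lam : ℝ) (a : ℕ → ℝ) (T : ℕ) (hT : 0 < T) (u : ℕ → Bool) :
    tailCost lam a T u (T - 1) (a 0) = Jd lam a T u := by
  have : Nonempty (Fin T) := ⟨⟨0, hT⟩⟩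
  refine eq_of_forall_ge_iff fun c => ?_
  have h := tailCost_le_iff lam a T u (T - 1) (by omega) c
  rw [Nat.sub_self] at h
  rw [Jd, ciSup_le_iff (Set.finite_range _).bddAbove]
  exact h.trans ⟨fun h t => h t (Nat.zero_le _) t.2, fun h t _ ht => h ⟨t, ht⟩⟩

theorem adm_iff_sum_Ico (T K : ℕ) (u : ℕ → Bool) :
    Adm T K u ↔ ∑ t ∈ Finset.Ico (T - 1 - (T - 1)) T, (if u t then 1 else 0) ≤ K := by
  rw [Nat.sub_self, ← Finset.range_eq_Ico]
  rfl

/-- `W̃_1(a_1, K)` equals the optimal cost of the deterministic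
control problem, `min` over admissible control sequences `u` of `J^d(u)`. -/
theorem stmt10 (T K : ℕ) (hK : 1 ≤ K) (hKT : K < T) (lam : ℝ)
    (a : ℕ → ℝ) (ha : ∀ t, 0 ≤ a t) :
    ∃ u : ℕ → Bool, Adm T K u ∧ (∀ u', Adm T K u' → Jd lam a T u ≤ Jd lam a T u') ∧
      tWfrom (tVv lam a T (T - 1)) (a 0) K = Jd lam a T u := by
  have hT : 0 < T := by omega
  obtain ⟨u, hu, h⟩ := exists_tailCost_eq_tWfrom lam a T (T - 1) (by omega) (a 0) K
  rw [tailCost_eq_Jd lam a T hT] at h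
  refine ⟨u, (adm_iff_sum_Ico T K u).2 hu, fun u' hu' => ?_, h⟩
  rw [← h, ← tailCost_eq_Jd lam a T hT u']
  exact tWfrom_le_tailCost lam a T u' _ (by omega) _ _ ((adm_iff_sum_Ico T K u').1 hu')
end
end

section
/- Suppose the noise radii are homogeneous: a_t = a ≥ 0 for all t, let Δ = ⌈(T+1)/(K+1)⌉, and let c* = a·(|λ|^{Δ−1} − 1)/(|λ| − 1) when |λ| ≠ 1 and c* = (Δ − 1)·a when |λ| = 1. Then the control sequence u defined by u_t = 1 if t ∈ {Δ, 2Δ, …, KΔ} ∩ {1, …, T} and u_t = 0 otherwise is admissible and satisfies J^d(u) = c* = min over admissible control sequences u′ of J^d(u′). -/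
noncomputable section

/-- `Δ = ⌈(T+1)/(K+1)⌉`. -/
def DeltaOf (T K : ℕ) : ℕ := ⌈((T : ℚ) + 1) / ((K : ℚ) + 1)⌉₊

-- The uniform transmission sequence: transmit (paper-indexed) at times
-- `{Δ, 2Δ, …, KΔ} ∩ {1, …, T}`; here 0-indexed, so `u i = 1` iff `i + 1 = m Δ`
-- for some `1 ≤ m ≤ K`.
open Classical in
def uUnif (T K : ℕ) : ℕ → Bool := fun i =>
  decide (∃ m ∈ Finset.Icc 1 K, i + 1 = m * DeltaOf T K)

/-- Number of steps since the last transmission (or since the start), counted from one. -/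
def age (u : ℕ → Bool) : ℕ → ℕ
  | 0 => 1
  | t + 1 => if u t then 1 else age u t + 1

lemma Xd_const_eq (lam a0 : ℝ) (u : ℕ → Bool) (t : ℕ) :
    Xd lam (fun _ => a0) u t = a0 * ∑ i ∈ Finset.range (age u t), |lam| ^ i := by
  induction t with
  | zero => simp [Xd, age]
  | succ t ih =>
    by_cases h : u t = true
    · simp [Xd, age, h]
    · simp only [Xd, age, h, ih]
      simp only [Bool.false_eq_true, if_false]
      rw [geom_sum_succ]
      ring

lemma mul_geom_sum_abs_mono {a0 : ℝ} (ha0 : 0 ≤ a0) (lam : ℝ) :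
    Monotone fun n : ℕ => a0 * ∑ i ∈ Finset.range n, |lam| ^ i := by
  intro m n hmn
  refine mul_le_mul_of_nonneg_left ?_ ha0
  exact Finset.sum_le_sum_of_subset_of_nonneg (Finset.range_mono hmn)
    fun i _ _ => by positivity

lemma le_Jd (lam : ℝ) (a : ℕ → ℝ) {T : ℕ} {u : ℕ → Bool} {t : ℕ} (ht : t < T)
    (hu : u t = false) : Xd lam a u t ≤ Jd lam a T u := by
  have h := le_ciSup (f := fun t : Fin T => if u t then 0 else Xd lam a u t)
    (Set.finite_range _).bddAbove ⟨t, ht⟩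
  simpa [Jd, hu] using h

lemma lt_succ_mul_DeltaOf (T K : ℕ) : T < (K + 1) * DeltaOf T K := by
  have h : ((T : ℚ) + 1) / ((K : ℚ) + 1) ≤ DeltaOf T K := Nat.le_ceil _
  rw [div_le_iff₀ (by positivity)] at h
  have h' : T + 1 ≤ DeltaOf T K * (K + 1) := by exact_mod_cast h
  linarith

lemma succ_mul_lt_of_lt_DeltaOf {T K D : ℕ} (hD : D < DeltaOf T K) : (K + 1) * D < T + 1 := by
  have h := Nat.lt_ceil.mp hD
  rw [lt_div_iff₀ (by positivity)] at h
  have h' : D * (K + 1) < T + 1 := by exact_mod_cast h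
  linarith

lemma two_le_DeltaOf {T K : ℕ} (hKT : K < T) : 2 ≤ DeltaOf T K := by
  refine Nat.lt_ceil.mpr ?_
  rw [lt_div_iff₀ (by positivity)]
  have : (K : ℚ) < T := by exact_mod_cast hKT
  push_cast
  linarith

lemma uUnif_eq_true_iff {T K t : ℕ} (ht : t < T) :
    uUnif T K t = true ↔ DeltaOf T K ∣ t + 1 := by
  simp only [uUnif, decide_eq_true_eq, Finset.mem_Icc]
  constructor
  · rintro ⟨m, -, hm⟩
    exact ⟨m, by rw [hm, mul_comm]⟩
  · rintro ⟨m, hm⟩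
    refine ⟨m, ⟨?_, ?_⟩, by rw [hm, mul_comm]⟩
    · rcases Nat.eq_zero_or_pos m with rfl | h
      · simp at hm
      · exact h
    · have hlt := lt_succ_mul_DeltaOf T K
      by_contra! h
      have := Nat.mul_le_mul_left (DeltaOf T K) (Nat.succ_le_of_lt h)
      rw [Nat.succ_eq_add_one, mul_comm _ (K + 1)] at this
      omega

lemma adm_uUnif (T K : ℕ) : Adm T K (uUnif T K) := by
  unfold Adm
  rw [← Finset.card_filter]
  calc _ ≤ ((Finset.Icc 1 K).image fun m => m * DeltaOf T K - 1).card := by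
        refine Finset.card_le_card fun t ht => ?_
        simp only [Finset.mem_filter, uUnif, decide_eq_true_eq] at ht
        obtain ⟨-, m, hm, h⟩ := ht
        exact Finset.mem_image.mpr ⟨m, hm, by omega⟩
    _ ≤ K := Finset.card_image_le.trans (by simp)

lemma mod_add_one_lt_of_not_dvd {n d : ℕ} (hd : 0 < d) (h : ¬ d ∣ n + 1) : n % d + 1 < d := by
  have hlt := Nat.mod_lt n hd
  refine lt_of_le_of_ne hlt fun he => h ⟨n / d + 1, ?_⟩
  have hdiv := Nat.div_add_mod n d
  rw [mul_add, mul_one]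
  omega

lemma age_uUnif {T K t : ℕ} (hKT : K < T) (ht : t < T) :
    age (uUnif T K) t = t % DeltaOf T K + 1 := by
  have h2 := two_le_DeltaOf hKT
  induction t with
  | zero => simp [age]
  | succ t ih =>
    have ih := ih (by omega)
    by_cases h : DeltaOf T K ∣ t + 1
    · simp [age, (uUnif_eq_true_iff (by omega)).mpr h, Nat.mod_eq_zero_of_dvd h]
    · have hu : uUnif T K t = false := by
        rw [← Bool.not_eq_true, uUnif_eq_true_iff (by omega)]
        exact h
      have h1 : 1 % DeltaOf T K = 1 := Nat.mod_eq_of_lt (by omega)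
      have hlt := mod_add_one_lt_of_not_dvd (by omega) h
      rw [Nat.add_mod_of_add_mod_lt (by omega), h1]
      simp [age, hu, ih]

lemma Jd_uUnif {T K : ℕ} (hKT : K < T) (lam : ℝ) {a0 : ℝ} (ha0 : 0 ≤ a0) :
    Jd lam (fun _ => a0) T (uUnif T K) =
      a0 * ∑ i ∈ Finset.range (DeltaOf T K - 1), |lam| ^ i := by
  have h2 := two_le_DeltaOf hKT
  have : Nonempty (Fin T) := ⟨⟨0, by omega⟩⟩
  apply le_antisymm
  · refine ciSup_le fun t => ?_
    split_ifs with hu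
    · positivity
    · rw [Xd_const_eq, age_uUnif hKT t.2]
      refine mul_geom_sum_abs_mono ha0 lam ?_
      rw [uUnif_eq_true_iff t.2] at hu
      have := mod_add_one_lt_of_not_dvd (by omega) hu
      omega
  · have hlt : DeltaOf T K - 2 < T := by
      have h := succ_mul_lt_of_lt_DeltaOf (show DeltaOf T K - 1 < DeltaOf T K by omega)
      have := Nat.le_mul_of_pos_left (DeltaOf T K - 1) K.add_one_pos
      omega
    have hu : uUnif T K (DeltaOf T K - 2) = false := by
      rw [← Bool.not_eq_true, uUnif_eq_true_iff hlt]
      intro h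
      have := Nat.le_of_dvd (by omega) h
      omega
    have h := le_Jd lam (fun _ => a0) hlt hu
    rwa [Xd_const_eq, age_uUnif hKT hlt, Nat.mod_eq_of_lt (by omega),
      show DeltaOf T K - 2 + 1 = DeltaOf T K - 1 by omega] at h

/-- If every step without transmission has age less than `D`, then ages never exceed `D`, and
the elapsed time is controlled by the number of transmissions. -/
lemma age_le_and_le_age_add {T D : ℕ} (hD : 1 ≤ D) {u : ℕ → Bool}
    (hu : ∀ t < T, u t = false → age u t < D) {t : ℕ} (ht : t ≤ T) :
    age u t ≤ D ∧
      t + 1 ≤ age u t + (∑ s ∈ Finset.range t, if u s then 1 else 0) * D := by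
  induction t with
  | zero => simpa [age] using hD
  | succ t ih =>
    obtain ⟨h1, h2⟩ := ih (by omega)
    rw [Finset.sum_range_succ, add_mul]
    by_cases h : u t = true
    · simp only [age, h, if_true]
      omega
    · have := hu t (by omega) (by simpa using h)
      simp only [age, h]
      simp only [Bool.false_eq_true, if_false]
      omega

lemma Adm.exists_le_age {T K : ℕ} (hKT : K < T) {u : ℕ → Bool} (hu : Adm T K u) :
    ∃ t < T, u t = false ∧ DeltaOf T K - 1 ≤ age u t := by
  have h2 := two_le_DeltaOf hKT
  by_contra! hlt
  obtain ⟨h, h'⟩ := age_le_and_le_age_add (show 1 ≤ DeltaOf T K - 1 by omega) hlt le_rfl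
  have hlt' := succ_mul_lt_of_lt_DeltaOf (show DeltaOf T K - 1 < DeltaOf T K by omega)
  have := Nat.mul_le_mul_right (DeltaOf T K - 1) hu
  rw [add_mul, one_mul] at hlt'
  omega

/-- under homogeneous noise radii `a_t = a ≥ 0`, the uniform
transmission sequence is admissible, achieves cost
`c* = a (|λ|^{Δ−1} − 1)/(|λ| − 1)` (resp. `(Δ − 1) a` when `|λ| = 1`),
and is optimal for the deterministic control problem. -/
theorem stmt18 (T K : ℕ) (hT : 1 ≤ T) (hK : 1 ≤ K) (hKT : K < T)
    (lam : ℝ) (a0 : ℝ) (ha0 : 0 ≤ a0) :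
    Adm T K (uUnif T K) ∧
    (|lam| ≠ 1 →
      Jd lam (fun _ => a0) T (uUnif T K) =
        a0 * (|lam| ^ (DeltaOf T K - 1) - 1) / (|lam| - 1)) ∧
    (|lam| = 1 →
      Jd lam (fun _ => a0) T (uUnif T K) = ((DeltaOf T K - 1 : ℕ) : ℝ) * a0) ∧
    (∀ u', Adm T K u' →
      Jd lam (fun _ => a0) T (uUnif T K) ≤ Jd lam (fun _ => a0) T u') := by
  refine ⟨adm_uUnif T K, fun h => ?_, fun h => ?_, fun u' hu' => ?_⟩
  · rw [Jd_uUnif hKT lam ha0, geom_sum_eq h, mul_div_assoc]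
  · rw [Jd_uUnif hKT lam ha0, h]
    simp [mul_comm]
  · obtain ⟨t, ht, hut, hage⟩ := hu'.exists_le_age hKT
    rw [Jd_uUnif hKT lam ha0]
    refine (mul_geom_sum_abs_mono ha0 lam hage).trans ?_
    simp only [← Xd_const_eq]
    exact le_Jd lam _ ht hut
end
end
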